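/- Let A ∈ ℝ^{n×n} be symmetric with distinct eigenvalues λ_{t₁}, …, λ_{t_s} (so s = |Λ*(A)|), let x₀ ∈ ℝⁿ be generic for A (its orthogonal projection onto every eigenspace of A is nonzero), and let k ≥ s. Then the error matrix E_k = A − Â_k = A(I − Π_k) has characteristic polynomial X^s · Π_{i=1}^s (X − λ_{t_i})^{m(λ_{t_i}) − 1}, where m(λ) = dim ker(A − λ I); that is, the spectrum of E_k (with multiplicity) consists of each eigenvalue of A repeated m(λ) − 1 times, together with 0 repeated s times. -/

import Mathlib

open Matrix Polynomial

/-- `P` is the orthogonal projection matrix (symmetric and idempotent) onto the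
subspace `W` of `ℝⁿ` (with the standard inner product). -/
def IsOrthProjOnto {n : ℕ} (P : Matrix (Fin n) (Fin n) ℝ) (W : Submodule ℝ (Fin n → ℝ)) : Prop :=
  P.IsSymm ∧ P * P = P ∧ LinearMap.range P.mulVecLin = W

/-- `krylovSpan A x₀ m = span {A^j x₀ : 0 ≤ j ≤ m − 1}` (the span of the first `m` snapshots). -/
def krylovSpan {n : ℕ} (A : Matrix (Fin n) (Fin n) ℝ) (x₀ : Fin n → ℝ) (m : ℕ) :
    Submodule ℝ (Fin n → ℝ) :=
  Submodule.span ℝ (Set.range fun j : Fin m => (A ^ (j : ℕ)).mulVec x₀)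

/-- `μ` is an eigenvalue of the real matrix `A`. -/
def IsEigenvalue {n : ℕ} (A : Matrix (Fin n) (Fin n) ℝ) (μ : ℝ) : Prop :=
  ∃ v : Fin n → ℝ, v ≠ 0 ∧ A.mulVec v = μ • v

/-- The multiplicity of `μ` as an eigenvalue of `A`: `dim ker (A − μ I)`. -/
noncomputable def eigMult {n : ℕ} (A : Matrix (Fin n) (Fin n) ℝ) (μ : ℝ) : ℕ :=
  Module.finrank ℝ (LinearMap.ker (Matrix.mulVecLin (A - μ • 1)))

lemma aeval_mulVec_of_mulVec_eq_smul {n : ℕ} {A : Matrix (Fin n) (Fin n) ℝ} {v : Fin n → ℝ}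
    {μ : ℝ} (hv : A *ᵥ v = μ • v) (p : ℝ[X]) : aeval A p *ᵥ v = p.eval μ • v := by
  induction p using Polynomial.induction_on' with
  | add p q hp hq => simp [Matrix.add_mulVec, hp, hq, add_smul]
  | monomial m a =>
    have hpow : ∀ m : ℕ, A ^ m *ᵥ v = μ ^ m • v := by
      intro m
      induction m with
      | zero => simp
      | succ m ih =>
        rw [pow_succ, ← Matrix.mulVec_mulVec, hv, Matrix.mulVec_smul, ih, smul_smul, pow_succ,
          mul_comm]
    rw [aeval_monomial, eval_monomial, ← Algebra.smul_def, Matrix.smul_mulVec, hpow, smul_smul]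

lemma Matrix.IsSymm.aeval {n : ℕ} {A : Matrix (Fin n) (Fin n) ℝ} (hA : A.IsSymm) (p : ℝ[X]) :
    (Polynomial.aeval A p).IsSymm := by
  induction p using Polynomial.induction_on' with
  | add p q hp hq => simpa using hp.add hq
  | monomial m a =>
    rw [aeval_monomial, ← Algebra.smul_def]
    exact (hA.pow m).smul a

lemma Matrix.IsSymm.exists_orthogonal_diagonalization {n : ℕ} {A : Matrix (Fin n) (Fin n) ℝ}
    (hA : A.IsSymm) : ∃ (V : Matrix (Fin n) (Fin n) ℝ) (d : Fin n → ℝ),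
      Vᵀ * V = 1 ∧ V * Vᵀ = 1 ∧ A = V * diagonal d * Vᵀ := by
  have hA' : A.IsHermitian := by
    rw [Matrix.IsHermitian, Matrix.conjTranspose_eq_transpose_of_trivial]; exact hA
  refine ⟨hA'.eigenvectorUnitary, hA'.eigenvalues, ?_, ?_, ?_⟩
  · simpa [Matrix.star_eq_conjTranspose] using Unitary.coe_star_mul_self hA'.eigenvectorUnitary
  · simpa [Matrix.star_eq_conjTranspose] using Unitary.coe_mul_star_self hA'.eigenvectorUnitary
  · have h := hA'.spectral_theorem
    rw [Unitary.conjStarAlgAut_apply] at h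
    simpa [Matrix.star_eq_conjTranspose, Function.comp_def] using h

section Diagonalization

variable {n : ℕ} {A V : Matrix (Fin n) (Fin n) ℝ} {d : Fin n → ℝ}

lemma mulVec_col_of_diagonalization (h₁ : Vᵀ * V = 1) (hA : A = V * diagonal d * Vᵀ)
    (i : Fin n) : A *ᵥ V.col i = d i • V.col i := by
  have h : A * V = V * diagonal d := by
    rw [hA, Matrix.mul_assoc, h₁, Matrix.mul_one]
  ext j
  have := congrFun (congrFun h j) i
  rw [Matrix.mul_diagonal] at this
  simpa [Matrix.mul_apply, Matrix.mulVec, dotProduct, mul_comm] using this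

lemma isEigenvalue_of_diagonalization (h₁ : Vᵀ * V = 1) (hA : A = V * diagonal d * Vᵀ)
    (i : Fin n) : IsEigenvalue A (d i) := by
  refine ⟨V.col i, fun h => ?_, mulVec_col_of_diagonalization h₁ hA i⟩
  have h' := congrFun (congrFun h₁ i) i
  rw [Matrix.mul_apply, Matrix.one_apply_eq] at h'
  have hz : ∀ j, V j i = 0 := fun j => congrFun h j
  simp [hz] at h'

lemma eigMult_eq_card_of_diagonalization (h₁ : Vᵀ * V = 1) (h₂ : V * Vᵀ = 1)
    (hA : A = V * diagonal d * Vᵀ) (μ : ℝ) :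
    eigMult A μ = (Finset.univ.filter fun i => d i = μ).card := by
  have hV : IsUnit V.det := by
    rw [← Matrix.isUnit_iff_isUnit_det]
    exact ⟨⟨V, Vᵀ, h₂, h₁⟩, rfl⟩
  have hV' : IsUnit Vᵀ.det := by rwa [Matrix.det_transpose]
  have hsub : A - μ • 1 = V * diagonal (fun i => d i - μ) * Vᵀ := by
    have : diagonal (fun i => d i - μ) = diagonal d - μ • (1 : Matrix (Fin n) (Fin n) ℝ) := by
      rw [Matrix.smul_one_eq_diagonal, Matrix.diagonal_sub]
    rw [this, Matrix.mul_sub, Matrix.sub_mul, ← hA, Matrix.mul_smul, Matrix.smul_mul,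
      Matrix.mul_one, h₂]
  have hrank : (A - μ • 1).rank = Fintype.card {i // d i - μ ≠ 0} := by
    rw [hsub, Matrix.rank_mul_eq_left_of_isUnit_det _ _ hV',
      Matrix.rank_mul_eq_right_of_isUnit_det _ _ hV, Matrix.rank_diagonal]
  have hnull := LinearMap.finrank_range_add_finrank_ker (A - μ • 1).mulVecLin
  rw [← Matrix.rank, hrank, Module.finrank_fin_fun] at hnull
  have hcard := Finset.card_filter_add_card_filter_not (s := (Finset.univ : Finset (Fin n)))
    (fun i => d i = μ)
  rw [Finset.card_univ, Fintype.card_fin] at hcard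
  rw [Fintype.card_subtype] at hnull
  simp only [sub_ne_zero, ne_eq] at hnull
  unfold eigMult
  omega

end Diagonalization

section Symmetric

variable {n : ℕ} {A : Matrix (Fin n) (Fin n) ℝ} {ev : Finset ℝ}

lemma charpoly_eq_prod_pow_eigMult (hA : A.IsSymm) (hev : ∀ μ : ℝ, μ ∈ ev ↔ IsEigenvalue A μ) :
    A.charpoly = ∏ μ ∈ ev, (X - C μ) ^ eigMult A μ := by
  obtain ⟨V, d, h₁, h₂, hd⟩ := hA.exists_orthogonal_diagonalization
  have hchar : A.charpoly = ∏ i, (X - C (d i)) := by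
    rw [hd, Matrix.charpoly_mul_comm, ← Matrix.mul_assoc, h₁, Matrix.one_mul,
      Matrix.charpoly_diagonal]
  rw [hchar, ← Finset.prod_fiberwise_of_maps_to (t := ev) (g := d)
    (fun i _ => (hev _).2 (isEigenvalue_of_diagonalization h₁ hd i))]
  refine Finset.prod_congr rfl fun μ _ => ?_
  rw [eigMult_eq_card_of_diagonalization h₁ h₂ hd, ← Finset.prod_const]
  refine Finset.prod_congr rfl fun i hi => ?_
  rw [(Finset.mem_filter.1 hi).2]

lemma aeval_eq_zero_of_eval_eigenvalues_eq_zero (hA : A.IsSymm) {p : ℝ[X]}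
    (hp : ∀ μ, IsEigenvalue A μ → p.eval μ = 0) : aeval A p = 0 := by
  obtain ⟨V, d, h₁, h₂, hd⟩ := hA.exists_orthogonal_diagonalization
  have hz : aeval A p * V = 0 := by
    ext j i
    have := congrFun (aeval_mulVec_of_mulVec_eq_smul
      (mulVec_col_of_diagonalization h₁ hd i) p) j
    rw [hp _ (isEigenvalue_of_diagonalization h₁ hd i), zero_smul] at this
    simpa [Matrix.mul_apply, Matrix.mulVec, dotProduct] using this
  rw [← Matrix.mul_one (aeval A p), ← h₂, ← Matrix.mul_assoc, hz, Matrix.zero_mul]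

lemma eigMult_pos {μ : ℝ} (h : IsEigenvalue A μ) : 0 < eigMult A μ := by
  obtain ⟨v, hv, hAv⟩ := h
  unfold eigMult
  rw [Module.finrank_pos_iff_exists_ne_zero]
  refine ⟨⟨v, ?_⟩, fun h => hv (congrArg Subtype.val h)⟩
  rw [LinearMap.mem_ker, Matrix.mulVecLin_apply, Matrix.sub_mulVec, hAv, Matrix.smul_mulVec,
    Matrix.one_mulVec, sub_self]

lemma Matrix.IsSymm.dotProduct_mulVec_comm (hA : A.IsSymm) (v w : Fin n → ℝ) :
    v ⬝ᵥ A *ᵥ w = A *ᵥ v ⬝ᵥ w := by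
  rw [Matrix.dotProduct_mulVec, ← Matrix.mulVec_transpose, hA.eq]

lemma dotProduct_eq_zero_of_eigenvectors (hA : A.IsSymm) {v w : Fin n → ℝ} {μ ν : ℝ}
    (hv : A *ᵥ v = μ • v) (hw : A *ᵥ w = ν • w) (hne : μ ≠ ν) : v ⬝ᵥ w = 0 := by
  have h := hA.dotProduct_mulVec_comm v w
  rw [hv, hw, dotProduct_smul, smul_dotProduct, smul_eq_mul, smul_eq_mul] at h
  have : (μ - ν) * (v ⬝ᵥ w) = 0 := by linarith
  exact (mul_eq_zero.1 this).resolve_left (sub_ne_zero.2 hne)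

lemma aeval_mulVec_mem_krylovSpan (x₀ : Fin n → ℝ) {p : ℝ[X]} {m : ℕ} (hp : p.natDegree < m) :
    aeval A p *ᵥ x₀ ∈ krylovSpan A x₀ m := by
  rw [aeval_eq_sum_range, Matrix.sum_mulVec]
  refine Submodule.sum_mem _ fun i hi => ?_
  rw [Matrix.smul_mulVec]
  exact Submodule.smul_mem _ _ (Submodule.subset_span
    ⟨⟨i, by have := Finset.mem_range.1 hi; omega⟩, rfl⟩)

/-- The normalized spectral components of a generic vector form an orthonormal family of
eigenvectors that lies in, and spans, its Krylov space. -/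
lemma exists_orthonormal_krylov_eigenvectors (hA : A.IsSymm)
    (hev : ∀ μ : ℝ, μ ∈ ev ↔ IsEigenvalue A μ) {x₀ : Fin n → ℝ}
    (hgen : ∀ μ ∈ ev, ∃ v : Fin n → ℝ, A *ᵥ v = μ • v ∧ v ⬝ᵥ x₀ ≠ 0)
    {m : ℕ} (hm : ev.card < m) :
    ∃ w : ev → Fin n → ℝ, (∀ μ, A *ᵥ w μ = (μ : ℝ) • w μ) ∧ (∀ μ, w μ ⬝ᵥ w μ = 1) ∧
      (∀ μ, w μ ∈ krylovSpan A x₀ m) ∧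
      krylovSpan A x₀ m ≤ Submodule.span ℝ (Set.range w) := by
  have hinj : Set.InjOn (id : ℝ → ℝ) ev := Function.injective_id.injOn
  set u : ev → Fin n → ℝ := fun μ => aeval A (Lagrange.basis ev id (μ : ℝ)) *ᵥ x₀
  have hAu : ∀ μ, A *ᵥ u μ = (μ : ℝ) • u μ := by
    intro μ
    have h0 : aeval A ((X - C (μ : ℝ)) * Lagrange.basis ev id (μ : ℝ)) = 0 := by
      refine aeval_eq_zero_of_eval_eigenvalues_eq_zero hA fun ν hν => ?_
      by_cases h : (μ : ℝ) = ν
      · simp [h]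
      · have := Lagrange.eval_basis_of_ne (v := id) h ((hev ν).2 hν)
        rw [eval_mul, show eval ν (Lagrange.basis ev id (μ : ℝ)) = 0 from this, mul_zero]
    have h1 := congrArg (· *ᵥ x₀) h0
    simp only [map_mul, map_sub, aeval_X, aeval_C, ← Matrix.mulVec_mulVec, Matrix.sub_mulVec,
      Matrix.zero_mulVec, Algebra.algebraMap_eq_smul_one, Matrix.smul_mulVec,
      Matrix.one_mulVec] at h1
    exact sub_eq_zero.1 h1
  have hu0 : ∀ μ, u μ ≠ 0 := by
    intro μ h
    obtain ⟨v, hv, hvx⟩ := hgen μ μ.2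
    apply hvx
    have h1 : v ⬝ᵥ u μ = v ⬝ᵥ x₀ := by
      rw [(hA.aeval _).dotProduct_mulVec_comm, aeval_mulVec_of_mulVec_eq_smul hv]
      have : eval (μ : ℝ) (Lagrange.basis ev id (μ : ℝ)) = 1 :=
        Lagrange.eval_basis_self hinj μ.2
      rw [this, one_smul]
    rw [← h1, h, dotProduct_zero]
  have hupos : ∀ μ, 0 < u μ ⬝ᵥ u μ := fun μ =>
    lt_of_le_of_ne (Finset.sum_nonneg fun i _ => mul_self_nonneg _)
      (Ne.symm fun h => hu0 μ (dotProduct_self_eq_zero.1 h))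
  have hsum : x₀ = ∑ μ, u μ := by
    rcases ev.eq_empty_or_nonempty with he | hne
    · have h1 : aeval A (1 : ℝ[X]) = 0 :=
        aeval_eq_zero_of_eval_eigenvalues_eq_zero hA fun ν hν => by
          have := (hev ν).2 hν
          simp [he] at this
      rw [map_one] at h1
      subst he
      rw [← Matrix.one_mulVec x₀, h1, Matrix.zero_mulVec, Finset.univ_eq_empty, Finset.sum_empty]
    · have h1 := congrArg (fun p => aeval A p *ᵥ x₀) (Lagrange.sum_basis hinj hne)
      simp only [map_sum, map_one, Matrix.one_mulVec, Matrix.sum_mulVec] at h1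
      rw [← h1, ← Finset.sum_coe_sort]
  set c : ev → ℝ := fun μ => √(u μ ⬝ᵥ u μ)
  have hc0 : ∀ μ, c μ ≠ 0 := fun μ => (Real.sqrt_pos.2 (hupos μ)).ne'
  refine ⟨fun μ => (c μ)⁻¹ • u μ, fun μ => ?_, fun μ => ?_, fun μ => ?_, ?_⟩
  · rw [Matrix.mulVec_smul, hAu, smul_comm]
  · have : c μ * c μ = u μ ⬝ᵥ u μ := Real.mul_self_sqrt (hupos μ).le
    rw [smul_dotProduct, dotProduct_smul, ← this]
    have := hc0 μ
    simp only [smul_eq_mul]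
    field_simp
  · refine Submodule.smul_mem _ _ (aeval_mulVec_mem_krylovSpan x₀ ?_)
    rw [Lagrange.natDegree_basis hinj μ.2]
    omega
  · refine Submodule.span_le.2 ?_
    rintro _ ⟨j, rfl⟩
    have hj : A ^ (j : ℕ) *ᵥ x₀ = ∑ μ : ev, (((μ : ℝ) ^ (j : ℕ)) * c μ) • (c μ)⁻¹ • u μ := by
      conv_lhs => rw [hsum]
      rw [Matrix.mulVec_sum]
      refine Finset.sum_congr rfl fun μ _ => ?_
      have := aeval_mulVec_of_mulVec_eq_smul (hAu μ) (X ^ (j : ℕ))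
      rw [map_pow, aeval_X, eval_pow, eval_X] at this
      rw [this, smul_smul, mul_assoc, mul_inv_cancel₀ (hc0 μ), mul_one]
    simp only [hj]
    exact Submodule.sum_mem _ fun μ _ => Submodule.smul_mem _ _ (Submodule.subset_span ⟨μ, rfl⟩)

end Symmetric

lemma IsOrthProjOnto.mulVec_eq_self {n : ℕ} {P : Matrix (Fin n) (Fin n) ℝ}
    {W : Submodule ℝ (Fin n → ℝ)} (hP : IsOrthProjOnto P W) {v : Fin n → ℝ} (hv : v ∈ W) :
    P *ᵥ v = v := by
  rw [← hP.2.2] at hv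
  obtain ⟨y, rfl⟩ := hv
  rw [Matrix.mulVecLin_apply, Matrix.mulVec_mulVec, hP.2.1]

lemma IsOrthProjOnto.eq_mul_transpose {n : ℕ} {ι : Type*} [Fintype ι] [DecidableEq ι]
    {P : Matrix (Fin n) (Fin n) ℝ} {W : Submodule ℝ (Fin n → ℝ)} (hP : IsOrthProjOnto P W)
    {U : Matrix (Fin n) ι ℝ} (hU : Uᵀ * U = 1) (hmem : ∀ i, U.col i ∈ W)
    (hspan : W ≤ Submodule.span ℝ (Set.range U.col)) : P = U * Uᵀ := by
  have hPU : P * U = U := by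
    ext j i
    have := congrFun (hP.mulVec_eq_self (hmem i)) j
    simpa [Matrix.mul_apply, Matrix.mulVec, dotProduct] using this
  have hUP : U * Uᵀ * P = P := by
    have hW : ∀ v ∈ W, (U * Uᵀ) *ᵥ v = v := by
      intro v hv
      have hv' := hspan hv
      rw [← Matrix.range_mulVecLin] at hv'
      obtain ⟨y, rfl⟩ := hv'
      rw [Matrix.mulVecLin_apply, Matrix.mulVec_mulVec, Matrix.mul_assoc, hU, Matrix.mul_one]
    refine Matrix.ext_of_mulVec_single fun i => ?_
    rw [← Matrix.mulVec_mulVec]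
    exact hW _ (hP.2.2 ▸ ⟨_, rfl⟩)
  have h := congrArg Matrix.transpose hUP
  rw [Matrix.transpose_mul, Matrix.transpose_mul, Matrix.transpose_transpose, hP.1.eq,
    ← Matrix.mul_assoc, hPU] at h
  exact h.symm

lemma charpoly_mul_charpoly_of_commute_idempotent {n : ℕ} {A P : Matrix (Fin n) (Fin n) ℝ}
    (hP : P * P = P) (hAP : A * P = P * A) :
    (A * P).charpoly * (A * (1 - P)).charpoly = X ^ n * A.charpoly := by
  have hzero : (A * P) * (A * (1 - P)) = 0 := by
    rw [hAP, Matrix.mul_assoc, ← Matrix.mul_assoc A A, Matrix.mul_sub, Matrix.mul_one,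
      Matrix.mul_sub, Matrix.mul_assoc A A P, hAP, ← Matrix.mul_assoc A P A, hAP,
      Matrix.mul_assoc P A A, ← Matrix.mul_assoc P P, hP, sub_self]
  have hsum : A * P + A * (1 - P) = A := by
    rw [← Matrix.mul_add, add_sub_cancel, Matrix.mul_one]
  have hX : (X : ℝ[X]) ^ n = (scalar (Fin n) (X : ℝ[X])).det := by simp
  rw [Matrix.charpoly, Matrix.charpoly, Matrix.charpoly, hX, ← Matrix.det_mul, ← Matrix.det_mul]
  congr 1
  have hz := congrArg (C : ℝ →+* ℝ[X]).mapMatrix hzero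
  have hs := congrArg (C : ℝ →+* ℝ[X]).mapMatrix hsum
  rw [map_mul, map_zero] at hz
  rw [map_add] at hs
  unfold Matrix.charmatrix
  rw [← hs]
  have hcomm : ∀ M : Matrix (Fin n) (Fin n) ℝ[X],
      M * scalar (Fin n) X = scalar (Fin n) X * M := fun M =>
    (Matrix.scalar_commute X (fun _ => Commute.all _ _) M).symm.eq
  generalize (C : ℝ →+* ℝ[X]).mapMatrix (A * P) = M at *
  generalize (C : ℝ →+* ℝ[X]).mapMatrix (A * (1 - P)) = N at *
  rw [Matrix.sub_mul, Matrix.mul_sub, Matrix.mul_sub, hz, hcomm M, sub_zero, Matrix.mul_sub,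
    Matrix.mul_add]
  abel

/-- `A` symmetric with distinct eigenvalues collected in `ev` (`|ev| = s`),
`x₀` generic for `A`, `k ≥ s`.  Then the error matrix `E_k = A − Â_k = A (I − Π_k)` has
characteristic polynomial `X^s · ∏_{λ ∈ ev} (X − λ)^{m(λ) − 1}`. -/
theorem stmt_12 {n s k : ℕ} (A : Matrix (Fin n) (Fin n) ℝ) (hA : A.IsSymm)
    (ev : Finset ℝ) (hev : ∀ μ : ℝ, μ ∈ ev ↔ IsEigenvalue A μ) (hcard : ev.card = s)
    (x₀ : Fin n → ℝ)
    (hgen : ∀ μ ∈ ev, ∃ v : Fin n → ℝ, A.mulVec v = μ • v ∧ v ⬝ᵥ x₀ ≠ 0)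
    (hk : s ≤ k)
    (Pk : Matrix (Fin n) (Fin n) ℝ)
    (hPk : IsOrthProjOnto Pk (krylovSpan A x₀ (k + 1))) :
    Matrix.charpoly (A * (1 - Pk))
      = X ^ s * ∏ μ ∈ ev, (X - C μ) ^ (eigMult A μ - 1) := by
  obtain ⟨w, hAw, hw1, hwmem, hwspan⟩ :=
    exists_orthonormal_krylov_eigenvectors (m := k + 1) hA hev hgen (by omega)
  set U : Matrix (Fin n) ev ℝ := Matrix.of fun i μ => w μ i
  set D : Matrix ev ev ℝ := diagonal fun μ => (μ : ℝ) with hD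
  have hU : Uᵀ * U = 1 := by
    ext μ ν
    change w μ ⬝ᵥ w ν = _
    by_cases h : μ = ν
    · rw [h, hw1, Matrix.one_apply_eq]
    · rw [Matrix.one_apply_ne h]
      exact dotProduct_eq_zero_of_eigenvectors hA (hAw μ) (hAw ν) (Subtype.coe_ne_coe.2 h)
  have hAU : A * U = U * D := by
    ext j μ
    rw [hD, Matrix.mul_diagonal, mul_comm]
    exact congrFun (hAw μ) j
  have hP : Pk = U * Uᵀ := hPk.eq_mul_transpose hU hwmem hwspan
  have hAP : A * Pk = U * (D * Uᵀ) := by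
    rw [hP, ← Matrix.mul_assoc, hAU, Matrix.mul_assoc]
  have hcomm : A * Pk = Pk * A := by
    have h : (A * Pk)ᵀ = A * Pk := by
      rw [hAP]
      simp [hD, Matrix.transpose_mul, Matrix.mul_assoc]
    rw [← h, Matrix.transpose_mul, hA.eq, hPk.1.eq]
  have hcharAP : X ^ s * (A * Pk).charpoly = X ^ n * ∏ μ ∈ ev, (X - C μ) := by
    have h := Matrix.charpoly_mul_comm' U (D * Uᵀ)
    rw [Matrix.mul_assoc, hU, Matrix.mul_one, Matrix.charpoly_diagonal, Fintype.card_coe, hcard,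
      Fintype.card_fin] at h
    rw [hAP, h, Finset.prod_coe_sort ev fun μ => X - C μ]
  have hmain := charpoly_mul_charpoly_of_commute_idempotent hPk.2.1 hcomm
  have hsplit : ∏ μ ∈ ev, (X - C μ) ^ eigMult A μ
      = (∏ μ ∈ ev, (X - C μ)) * ∏ μ ∈ ev, (X - C μ) ^ (eigMult A μ - 1) := by
    rw [← Finset.prod_mul_distrib]
    refine Finset.prod_congr rfl fun μ hμ => ?_
    rw [mul_pow_sub_one (eigMult_pos ((hev μ).1 hμ)).ne']
  rw [charpoly_eq_prod_pow_eigMult hA hev, hsplit] at hmain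
  have hne : (X : ℝ[X]) ^ n * ∏ μ ∈ ev, (X - C μ) ≠ 0 :=
    mul_ne_zero (pow_ne_zero _ X_ne_zero) (Finset.prod_ne_zero_iff.2 fun μ _ => X_sub_C_ne_zero μ)
  refine mul_left_cancel₀ hne ?_
  rw [← hcharAP, mul_assoc, hmain, mul_left_comm (_ * _) (X ^ s), hcharAP]
  ring
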